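/- arXiv:2207.05443 — 3 statements merged into one kernel-verified Lean document; each statement's English description precedes it below -/
import Mathlib

section
/- Let $H$ be a finite-dimensional complex Hilbert space of complex dimension $d$, and let $\hat H$ be its unit sphere equipped with the surface measure induced from Lebesgue measure on $H$. For any $N, M \in \mathbb{N}$ and vectors $a_1,\dots,a_M, b_1,\dots,b_N \in H$, one has $\int_{\hat H} \prod_{i=1}^M \langle a_i,\hat\varphi\rangle \prod_{j=1}^N \langle \hat\varphi, b_j\rangle \, d\hat\varphi = \delta_{NM} \, \frac{2\pi^d}{(N+d-1)!} \sum_{\sigma \in \mathfrak{S}_N} \prod_{i=1}^N \langle a_i, b_{\sigma(i)}\rangle$, where $\mathfrak{S}_N$ is the set of permutations of $N$ elements. -/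
open MeasureTheory Metric
open scoped InnerProductSpace

noncomputable instance (d : ℕ) : MeasurableSpace (EuclideanSpace ℂ (Fin d)) := borel _
instance (d : ℕ) : BorelSpace (EuclideanSpace ℂ (Fin d)) := ⟨rfl⟩
noncomputable instance (d : ℕ) : InnerProductSpace ℝ (EuclideanSpace ℂ (Fin d)) :=
  InnerProductSpace.rclikeToReal ℂ _

/-- The surface measure on the unit sphere of a finite-dimensional complex Hilbert space,
induced from Lebesgue measure. -/
noncomputable def sphereMeasure (d : ℕ) :
    Measure (sphere (0 : EuclideanSpace ℂ (Fin d)) 1) :=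
  (volume : Measure (EuclideanSpace ℂ (Fin d))).toSphere

namespace SphereAux

set_option linter.unusedSectionVars false

variable {E : Type*} [NormedAddCommGroup E] [InnerProductSpace ℂ E]

/-- Continuous functions of polynomial growth. -/
def PG (f : E → ℂ) : Prop :=
  Continuous f ∧ ∃ (C : ℝ) (k : ℕ), 0 ≤ C ∧ ∀ x, ‖f x‖ ≤ C * (1 + ‖x‖) ^ k

lemma PG.const (c : ℂ) : PG (fun _ : E => c) :=
  ⟨continuous_const, ‖c‖, 0, norm_nonneg _, fun x => by simp⟩

lemma PG.mul {f g : E → ℂ} (hf : PG f) (hg : PG g) : PG (fun x => f x * g x) := by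
  obtain ⟨hf, C, k, hC, h1⟩ := hf
  obtain ⟨hg, D, l, hD, h2⟩ := hg
  refine ⟨hf.mul hg, C * D, k + l, by positivity, fun x => ?_⟩
  rw [norm_mul]
  calc ‖f x‖ * ‖g x‖ ≤ (C * (1 + ‖x‖) ^ k) * (D * (1 + ‖x‖) ^ l) := by
        gcongr
        · exact h1 x
        · exact h2 x
    _ = _ := by ring

lemma PG.add {f g : E → ℂ} (hf : PG f) (hg : PG g) : PG (fun x => f x + g x) := by
  obtain ⟨hf, C, k, hC, h1⟩ := hf
  obtain ⟨hg, D, l, hD, h2⟩ := hg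
  refine ⟨hf.add hg, C + D, k + l, by positivity, fun x => ?_⟩
  have hx : 1 ≤ 1 + ‖x‖ := by linarith [norm_nonneg x]
  calc ‖f x + g x‖ ≤ ‖f x‖ + ‖g x‖ := norm_add_le _ _
    _ ≤ C * (1 + ‖x‖) ^ k + D * (1 + ‖x‖) ^ l := add_le_add (h1 x) (h2 x)
    _ ≤ C * (1 + ‖x‖) ^ (k + l) + D * (1 + ‖x‖) ^ (k + l) := by
        gcongr <;> first | exact hx | omega
    _ = _ := by ring

lemma PG.prod {ι : Type*} (s : Finset ι) {f : ι → E → ℂ} (hf : ∀ i, PG (f i)) :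
    PG (fun x => ∏ i ∈ s, f i x) := by
  classical
  induction s using Finset.induction_on with
  | empty => simpa using PG.const 1
  | insert i s hi ih => simp only [Finset.prod_insert hi]; exact (hf i).mul ih

lemma PG.sum {ι : Type*} (s : Finset ι) {f : ι → E → ℂ} (hf : ∀ i, PG (f i)) :
    PG (fun x => ∑ i ∈ s, f i x) := by
  classical
  induction s using Finset.induction_on with
  | empty => simpa using PG.const 0
  | insert i s hi ih => simp only [Finset.sum_insert hi]; exact (hf i).add ih

lemma PG.inner_left (a : E) : PG (fun x => ⟪a, x⟫_ℂ) := by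
  refine ⟨by fun_prop, ‖a‖, 1, norm_nonneg _, fun x => ?_⟩
  refine (norm_inner_le_norm a x).trans ?_
  gcongr
  simp

lemma PG.inner_right (a : E) : PG (fun x => ⟪x, a⟫_ℂ) := by
  refine ⟨by fun_prop, ‖a‖, 1, norm_nonneg _, fun x => ?_⟩
  refine (norm_inner_le_norm x a).trans ?_
  rw [mul_comm]
  gcongr
  simp

lemma PG.re (v : E) : PG (fun x => ((⟪v, x⟫_ℂ).re : ℂ)) := by
  refine ⟨by fun_prop, ‖v‖, 1, norm_nonneg _, fun x => ?_⟩
  rw [Complex.norm_real]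
  refine (Complex.abs_re_le_norm _).trans ((norm_inner_le_norm v x).trans ?_)
  gcongr
  simp

/-- The Gaussian. -/
noncomputable def G (x : E) : ℂ := ((Real.exp (-‖x‖ ^ 2) : ℝ) : ℂ)

/-- The monomial. -/
noncomputable def P {M N : ℕ} (a : Fin M → E) (b : Fin N → E) (x : E) : ℂ :=
  (∏ i, ⟪a i, x⟫_ℂ) * ∏ j, ⟪x, b j⟫_ℂ

lemma PG_P {M N : ℕ} (a : Fin M → E) (b : Fin N → E) : PG (P a b) :=
  (PG.prod _ fun i => PG.inner_left (a i)).mul (PG.prod _ fun j => PG.inner_right (b j))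

variable [InnerProductSpace ℝ E] [IsScalarTower ℝ ℂ E] 

lemma PG.integrable [FiniteDimensional ℝ E] [MeasurableSpace E] [BorelSpace E]
    {f : E → ℂ} (hf : PG f) : Integrable (fun x => f x * G x) := by
  obtain ⟨hf, C, k, hC, h1⟩ := hf
  have hi : Integrable (fun x : E => Real.exp (-(1/2) * ‖x‖ ^ 2)) := by
    have := (GaussianFourier.integrable_cexp_neg_mul_sq_norm_add (V := E) (b := (1/2 : ℂ))
      (by norm_num) 0 0).norm
    refine this.congr (Filter.Eventually.of_forall fun x => ?_)
    simp [Complex.norm_exp, ← Complex.ofReal_pow]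
  refine (hi.const_mul (C * (k.factorial * Real.exp 2))).mono' ?_ (Filter.Eventually.of_forall fun x => ?_)
  · apply Continuous.aestronglyMeasurable
    unfold G
    fun_prop
  · have h2 : (1 + ‖x‖) ^ k ≤ k.factorial * Real.exp (1 + ‖x‖) := by
      have := Real.pow_div_factorial_le_exp (1 + ‖x‖) (by positivity) k
      rw [div_le_iff₀ (by positivity)] at this
      linarith
    rw [norm_mul, G, Complex.norm_real, Real.norm_eq_abs, Real.abs_exp]
    calc ‖f x‖ * Real.exp (-‖x‖ ^ 2)
        ≤ (C * (k.factorial * Real.exp (1 + ‖x‖))) * Real.exp (-‖x‖ ^ 2) := by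
          gcongr
          exact (h1 x).trans (by gcongr)
      _ = C * k.factorial * Real.exp (1 + ‖x‖ - ‖x‖ ^ 2) := by
          rw [sub_eq_add_neg, Real.exp_add (1 + ‖x‖)]; ring
      _ ≤ C * k.factorial * Real.exp (2 + -(1/2) * ‖x‖ ^ 2) := by
          gcongr
          nlinarith [sq_nonneg (‖x‖ - 1)]
      _ = _ := by rw [Real.exp_add]; ring

lemma hasLineDerivAt_G (x v : E) :
    HasLineDerivAt ℝ (G : E → ℂ) (-2 * ((⟪v, x⟫_ℂ).re : ℂ) * G x) x v := by
  unfold HasLineDerivAt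
  have h : ∀ t : ℝ, ‖x + t • v‖ ^ 2 = ‖x‖ ^ 2 + 2 * t * (⟪v, x⟫_ℂ).re + t ^ 2 * ‖v‖ ^ 2 := by
    intro t
    rw [← algebraMap_smul ℂ t v, @norm_add_sq ℂ, norm_smul, inner_smul_right, ← inner_conj_symm x v,
      mul_pow]
    have e : ‖(algebraMap ℝ ℂ) t‖ ^ 2 = t ^ 2 := by simp
    rw [e]
    simp only [Complex.coe_algebraMap, RCLike.re_eq_complex_re, Complex.re_ofReal_mul,
      Complex.conj_re]
    ring
  unfold G
  simp only [h]
  have h1 : HasDerivAt (fun t : ℝ => -(‖x‖ ^ 2 + 2 * t * (⟪v, x⟫_ℂ).re + t ^ 2 * ‖v‖ ^ 2))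
      (-(2 * (⟪v, x⟫_ℂ).re)) 0 := by
    have h2 : HasDerivAt (fun t : ℝ => 2 * t * (⟪v, x⟫_ℂ).re) (2 * (⟪v, x⟫_ℂ).re) 0 := by
      simpa using ((hasDerivAt_id (0:ℝ)).const_mul 2).mul_const (⟪v, x⟫_ℂ).re
    have h3 : HasDerivAt (fun t : ℝ => t ^ 2 * ‖v‖ ^ 2) 0 0 := by
      simpa using ((hasDerivAt_id (0:ℝ)).pow 2).mul_const (‖v‖ ^ 2)
    have h4 := ((h2.const_add (‖x‖ ^ 2)).add h3).neg
    rw [add_zero] at h4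
    exact h4
  have h2 := h1.exp.ofReal_comp
  have h3 : ((Real.exp (-(‖x‖ ^ 2 + 2 * 0 * (⟪v, x⟫_ℂ).re + 0 ^ 2 * ‖v‖ ^ 2)) *
      -(2 * (⟪v, x⟫_ℂ).re) : ℝ) : ℂ) =
      -2 * ((⟪v, x⟫_ℂ).re : ℂ) * ((Real.exp (-‖x‖ ^ 2) : ℝ) : ℂ) := by
    have e : ‖x‖ ^ 2 + 2 * 0 * (⟪v, x⟫_ℂ).re + 0 ^ 2 * ‖v‖ ^ 2 = ‖x‖ ^ 2 := by ring
    rw [e]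
    push_cast
    ring
  rw [h3] at h2
  exact h2

lemma ibp [FiniteDimensional ℝ E] [MeasurableSpace E] [BorelSpace E]
    {f f' : E → ℂ} {v : E} (hf : PG f) (hf' : PG f') (h : ∀ x, HasLineDerivAt ℝ f (f' x) x v) :
    ∫ x, f x * (2 * ((⟪v, x⟫_ℂ).re : ℂ)) * G x = ∫ x, f' x * G x := by
  have := integral_bilinear_hasLineDerivAt_right_eq_neg_left_of_integrable
    (μ := (volume : Measure E)) (B := ContinuousLinearMap.mul ℝ ℂ)
    (f := f) (f' := f') (g := G) (g' := fun x => -2 * ((⟪v, x⟫_ℂ).re : ℂ) * G x) (v := v)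
    hf'.integrable ?_ hf.integrable (fun x _ => h x) (fun x _ => hasLineDerivAt_G x v)
  · simp only [ContinuousLinearMap.mul_apply'] at this
    rw [← neg_inj, ← this, ← integral_neg]
    congr 1
    ext x
    ring
  · have h1 : PG (fun x => f x * (-2 * ((⟪v, x⟫_ℂ).re : ℂ))) :=
      hf.mul ((PG.const _).mul (PG.re v))
    simpa [mul_assoc] using h1.integrable

/-- Directional derivative of the monomial. -/
noncomputable def DP {M N : ℕ} (a : Fin M → E) (b : Fin N → E) (v x : E) : ℂ :=
  (∑ i, (∏ k ∈ Finset.univ.erase i, ⟪a k, x⟫_ℂ) * ⟪a i, v⟫_ℂ) * (∏ j, ⟪x, b j⟫_ℂ) +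
  (∏ i, ⟪a i, x⟫_ℂ) * (∑ j, (∏ k ∈ Finset.univ.erase j, ⟪x, b k⟫_ℂ) * ⟪v, b j⟫_ℂ)

lemma PG_DP {M N : ℕ} (a : Fin M → E) (b : Fin N → E) (v : E) : PG (DP a b v) := by
  refine PG.add (PG.mul (PG.sum _ fun i => PG.mul (PG.prod _ fun i => PG.inner_left (a i))
    (PG.const _)) (PG.prod _ fun j => PG.inner_right (b j))) (PG.mul
    (PG.prod _ fun i => PG.inner_left (a i)) (PG.sum _ fun i => PG.mul
    (PG.prod _ fun i => PG.inner_right (b i)) (PG.const _)))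

lemma hasLineDerivAt_P {M N : ℕ} (a : Fin M → E) (b : Fin N → E) (v x : E) :
    HasLineDerivAt ℝ (P a b) (DP a b v x) x v := by
  unfold HasLineDerivAt P DP
  have h1 : ∀ a : E, HasDerivAt (fun t : ℝ => ⟪a, x + t • v⟫_ℂ) ⟪a, v⟫_ℂ 0 := by
    intro a
    have : ∀ t : ℝ, ⟪a, x + t • v⟫_ℂ = ⟪a, x⟫_ℂ + (t : ℂ) * ⟪a, v⟫_ℂ := by
      intro t
      rw [← algebraMap_smul ℂ t v, inner_add_right, inner_smul_right]; simp
    simp only [this]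
    simpa using ((hasDerivAt_id (0:ℝ)).ofReal_comp.mul_const ⟪a, v⟫_ℂ).const_add ⟪a, x⟫_ℂ
  have h2 : ∀ b : E, HasDerivAt (fun t : ℝ => ⟪x + t • v, b⟫_ℂ) ⟪v, b⟫_ℂ 0 := by
    intro a
    have : ∀ t : ℝ, ⟪x + t • v, a⟫_ℂ = ⟪x, a⟫_ℂ + (t : ℂ) * ⟪v, a⟫_ℂ := by
      intro t
      rw [← algebraMap_smul ℂ t v, inner_add_left, inner_smul_left]; simp
    simp only [this]
    simpa using ((hasDerivAt_id (0:ℝ)).ofReal_comp.mul_const ⟪v, a⟫_ℂ).const_add ⟪x, a⟫_ℂ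
  have h3 := HasDerivAt.fun_finsetProd (u := Finset.univ) (fun i _ => h1 (a i))
  have h4 := HasDerivAt.fun_finsetProd (u := Finset.univ) (fun i _ => h2 (b i))
  have h5 := h3.mul h4
  simp only [zero_smul, add_zero, smul_eq_mul] at h5
  exact h5

lemma DP_comb {M N : ℕ} (a : Fin M → E) (b : Fin N → E) (v x : E) :
    DP a b v x + Complex.I * DP a b (Complex.I • v) x =
      2 * ((∏ i, ⟪a i, x⟫_ℂ) *
        (∑ j, (∏ k ∈ Finset.univ.erase j, ⟪x, b k⟫_ℂ) * ⟪v, b j⟫_ℂ)) := by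
  unfold DP
  simp only [inner_smul_left, inner_smul_right, Complex.conj_I]
  have e1 : ∀ (n : ℕ) (f g : Fin n → ℂ) (c : ℂ), ∑ i, f i * (c * g i) = c * ∑ i, f i * g i := by
    intro n f g c
    rw [Finset.mul_sum]
    exact Finset.sum_congr rfl fun i _ => by ring
  rw [e1, e1]
  linear_combination ((∑ i, (∏ k ∈ Finset.univ.erase i, ⟪a k, x⟫_ℂ) * ⟪a i, v⟫_ℂ) * (∏ j, ⟪x, b j⟫_ℂ) - (∏ i, ⟪a i, x⟫_ℂ) * (∑ j, (∏ k ∈ Finset.univ.erase j, ⟪x, b k⟫_ℂ) * ⟪v, b j⟫_ℂ)) * Complex.I_sq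

lemma step [FiniteDimensional ℝ E] [MeasurableSpace E] [BorelSpace E]
    {M N : ℕ} (a : Fin (M + 1) → E) (b : Fin N → E) :
    ∫ x, P a b x * G x = ∑ j, ⟪a 0, b j⟫_ℂ * ∫ x, ((∏ i, ⟪a (Fin.succ i), x⟫_ℂ) *
        (∏ k ∈ Finset.univ.erase j, ⟪x, b k⟫_ℂ)) * G x := by
  set a' : Fin M → E := fun i => a i.succ
  have hP := PG_P a' b
  have h1 := ibp hP (PG_DP a' b (a 0)) (hasLineDerivAt_P a' b (a 0))
  have h2 := ibp hP (PG_DP a' b (Complex.I • a 0)) (hasLineDerivAt_P a' b (Complex.I • a 0))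
  have i1 : ∀ v, Integrable (fun x => P a' b x * (2 * ((⟪v, x⟫_ℂ).re : ℂ)) * G x) :=
    fun v => (hP.mul ((PG.const 2).mul (PG.re v))).integrable
  have h3 : 2 * ∫ x, P a b x * G x =
      (∫ x, P a' b x * (2 * ((⟪a 0, x⟫_ℂ).re : ℂ)) * G x) +
      Complex.I * ∫ x, P a' b x * (2 * ((⟪Complex.I • a 0, x⟫_ℂ).re : ℂ)) * G x := by
    rw [← integral_const_mul, ← integral_const_mul, ← integral_add (i1 _) ((i1 _).const_mul _)]
    congr 1
    ext x
    have : P a b x = ⟪a 0, x⟫_ℂ * P a' b x := by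
      unfold P; rw [Fin.prod_univ_succ]; ring
    rw [this, inner_smul_left]
    have h4 := Complex.re_add_im ⟪a 0, x⟫_ℂ
    have h5 : ((starRingEnd ℂ) Complex.I * ⟪a 0, x⟫_ℂ).re = (⟪a 0, x⟫_ℂ).im := by simp
    rw [h5]
    linear_combination -2 * P a' b x * G x * h4
  have j1 : ∀ v, Integrable (fun x => DP a' b v x * G x) := fun v => (PG_DP a' b v).integrable
  rw [h1, h2, ← integral_const_mul Complex.I, ← integral_add (j1 _) ((j1 _).const_mul _)] at h3
  have h4 : ∫ x, (DP a' b (a 0) x * G x + Complex.I * (DP a' b (Complex.I • a 0) x * G x)) =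
      ∫ x, 2 * ∑ j, ⟪a 0, b j⟫_ℂ * (((∏ i, ⟪a' i, x⟫_ℂ) *
        (∏ k ∈ Finset.univ.erase j, ⟪x, b k⟫_ℂ)) * G x) := by
    congr 1
    ext x
    have := DP_comb a' b (a 0) x
    have e : ∑ j, ⟪a 0, b j⟫_ℂ * (((∏ i, ⟪a' i, x⟫_ℂ) *
        (∏ k ∈ Finset.univ.erase j, ⟪x, b k⟫_ℂ)) * G x) = ((∏ i, ⟪a' i, x⟫_ℂ) *
        (∑ j, (∏ k ∈ Finset.univ.erase j, ⟪x, b k⟫_ℂ) * ⟪a 0, b j⟫_ℂ)) * G x := by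
      rw [Finset.mul_sum, Finset.sum_mul]
      exact Finset.sum_congr rfl fun i _ => by ring
    rw [e]
    linear_combination G x * this
  rw [h4, integral_const_mul, integral_finsetSum] at h3
  · simp only [integral_const_mul] at h3
    exact mul_left_cancel₀ two_ne_zero h3
  · intro j _
    exact (PG.integrable ((PG.prod _ fun i => PG.inner_left (a' i)).mul
      (PG.prod _ fun i => PG.inner_right (b i)))).const_mul _

lemma prod_erase_swap {N : ℕ} (f : Fin (N + 1) → ℂ) (j : Fin (N + 1)) :
    ∏ k ∈ Finset.univ.erase j, f k = ∏ k : Fin N, f (Equiv.swap 0 j k.succ) := by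
  symm
  refine Finset.prod_bij (fun k _ => Equiv.swap 0 j k.succ) ?_ ?_ ?_ ?_
  · intro k _
    simp only [Finset.mem_erase, Finset.mem_univ, and_true]
    intro h
    have := (Equiv.swap 0 j).injective (h.trans (Equiv.swap_apply_left 0 j).symm)
    exact Fin.succ_ne_zero _ this
  · intro k _ l _ h
    exact Fin.succ_injective _ ((Equiv.swap 0 j).injective h)
  · intro l hl
    have : Equiv.swap 0 j l ≠ 0 := by
      intro h
      have h' : Equiv.swap 0 j l = Equiv.swap 0 j j := by simp [h]
      exact (Finset.mem_erase.1 hl).1 ((Equiv.swap 0 j).injective h')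
    obtain ⟨k, hk⟩ := Fin.exists_succ_eq.2 this
    exact ⟨k, Finset.mem_univ _, by simp [hk]⟩
  · intros; rfl

lemma step' [FiniteDimensional ℝ E] [MeasurableSpace E] [BorelSpace E]
    {M N : ℕ} (a : Fin (M + 1) → E) (b : Fin (N + 1) → E) :
    ∫ x, P a b x * G x = ∑ j, ⟪a 0, b j⟫_ℂ *
      ∫ x, P (fun i : Fin M => a i.succ) (fun k : Fin N => b (Equiv.swap 0 j k.succ)) x * G x := by
  rw [step]
  unfold P
  simp only [prod_erase_swap]

lemma wick_eq [FiniteDimensional ℝ E] [MeasurableSpace E] [BorelSpace E]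
    {N : ℕ} (a b : Fin N → E) :
    ∫ x, P a b x * G x = (∫ x : E, G x) * ∑ σ : Equiv.Perm (Fin N), ∏ i, ⟪a i, b (σ i)⟫_ℂ := by
  induction N with
  | zero => simp [P]
  | succ N ih =>
    rw [step', ← Equiv.Perm.decomposeFin.symm.sum_comp, Fintype.sum_prod_type, Finset.mul_sum]
    refine Finset.sum_congr rfl fun j _ => ?_
    rw [ih]
    simp only [Fin.prod_univ_succ, Equiv.Perm.decomposeFin_symm_apply_zero,
      Equiv.Perm.decomposeFin_symm_apply_succ, ← Finset.mul_sum]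
    ring

lemma wick_ne [FiniteDimensional ℝ E] [MeasurableSpace E] [BorelSpace E]
    {M N : ℕ} (h : N ≠ M) (a : Fin M → E) (b : Fin N → E) :
    ∫ x, P a b x * G x = 0 := by
  have z : ∀ (M : ℕ) (a : Fin (M + 1) → E) (b : Fin 0 → E), ∫ x, P a b x * G x = 0 := by
    intro M a b
    rw [step]; simp
  induction M generalizing N with
  | zero =>
    obtain ⟨n, rfl⟩ := Nat.exists_eq_succ_of_ne_zero h
    have h1 := z n b a
    have h2 : ∀ x, P a b x * G x = (starRingEnd ℂ) (P b a x * G x) := by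
      intro x
      unfold P G
      simp only [map_mul, map_prod, inner_conj_symm, Complex.conj_ofReal]
      ring
    simp only [h2]
    rw [integral_conj, h1, map_zero]
  | succ M ih =>
    cases N with
    | zero => exact z _ _ _
    | succ N =>
      rw [step']
      refine Finset.sum_eq_zero fun j _ => ?_
      rw [ih (by omega), mul_zero]

lemma polar [FiniteDimensional ℝ E] [MeasurableSpace E] [BorelSpace E] [Nontrivial E]
    {M N : ℕ} (a : Fin M → E) (b : Fin N → E) :
    ∫ x, P a b x * G x = (∫ x : sphere (0 : E) 1, P a b x ∂(volume : Measure E).toSphere) *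
      ((1 / 2 * Real.Gamma (((M + N + Module.finrank ℝ E : ℕ) : ℝ) / 2) : ℝ) : ℂ) := by
  have hn : 0 < Module.finrank ℝ E := Module.finrank_pos
  set n := Module.finrank ℝ E with hndef
  calc
    ∫ x, P a b x * G x = ∫ x : ({(0)}ᶜ : Set E), P a b x * G x.1 ∂((volume : Measure E).comap (↑)) := by
      rw [integral_subtype_comap (measurableSet_singleton _).compl fun x ↦ P a b x * G x,
        restrict_compl_singleton]
    _ = ∫ x : sphere (0 : E) 1 × Set.Ioi (0 : ℝ),
        P a b x.1 * (((x.2 : ℝ) ^ (M + N) * Real.exp (-(x.2 : ℝ) ^ 2) : ℝ) : ℂ)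
        ∂(volume : Measure E).toSphere.prod (.volumeIoiPow (n - 1)) := by
      rw [← (volume : Measure E).measurePreserving_homeomorphUnitSphereProd.integral_comp
        (Homeomorph.measurableEmbedding _)]
      congr 1
      ext x
      have hx : (0 : ℝ) < ‖x.1‖ := norm_pos_iff.2 x.2
      have hx' : ((‖x.1‖ : ℝ) : ℂ) ≠ 0 := by exact_mod_cast hx.ne'
      have e : x.1 = ((‖x.1‖ : ℝ) : ℂ) • ((homeomorphUnitSphereProd E x).1 : E) := by
        rw [homeomorphUnitSphereProd_apply_fst_coe, ← algebraMap_smul ℂ (‖x.1‖⁻¹) x.1, smul_smul]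
        simp [hx']
      have e2 : P a b x.1 = ((‖x.1‖ : ℝ) : ℂ) ^ (M + N) * P a b (homeomorphUnitSphereProd E x).1 := by
        conv_lhs => rw [e]
        unfold P
        simp only [inner_smul_left, inner_smul_right, Finset.prod_mul_distrib, Complex.conj_ofReal]
        simp only [Finset.prod_const, Finset.card_univ, Fintype.card_fin]
        ring
      rw [homeomorphUnitSphereProd_apply_snd_coe, e2, G]
      push_cast
      ring
    _ = (∫ x : sphere (0 : E) 1, P a b x ∂(volume : Measure E).toSphere) *
        ∫ r : Set.Ioi (0 : ℝ), (((r : ℝ) ^ (M + N) * Real.exp (-(r : ℝ) ^ 2) : ℝ) : ℂ)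
          ∂(.volumeIoiPow (n - 1)) :=
      integral_prod_mul (fun x : sphere (0 : E) 1 => P a b x)
        (fun r : Set.Ioi (0 : ℝ) => (((r : ℝ) ^ (M + N) * Real.exp (-(r : ℝ) ^ 2) : ℝ) : ℂ))
    _ = _ := by
      congr 1
      rw [integral_complex_ofReal]
      congr 1
      simp only [Measure.volumeIoiPow, ENNReal.ofReal]
      rw [integral_withDensity_eq_integral_smul, 
        integral_subtype_comap measurableSet_Ioi fun r : ℝ ↦ Real.toNNReal (r ^ (n - 1)) • (r ^ (M + N) * Real.exp (-r ^ 2))]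
      · have := integral_rpow_mul_exp_neg_rpow (p := 2) (q := ((M + N + n - 1 : ℕ) : ℝ)) (by norm_num)
          (lt_of_lt_of_le (by norm_num) (Nat.cast_nonneg _))
        have e : ((M + N + n - 1 : ℕ) : ℝ) + 1 = ((M + N + n : ℕ) : ℝ) := by
          rw [← Nat.cast_succ]; congr 1; omega
        rw [e] at this
        rw [← this]
        refine setIntegral_congr_fun measurableSet_Ioi fun r hr => ?_
        rw [NNReal.smul_def, Real.coe_toNNReal _ (pow_nonneg hr.out.le _), Real.rpow_natCast,
          smul_eq_mul, ← mul_assoc, ← pow_add, Real.rpow_two]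
        congr 2
        omega
      · exact (measurable_subtype_coe.pow_const _).real_toNNReal

lemma integral_G [FiniteDimensional ℝ E] [MeasurableSpace E] [BorelSpace E] (d : ℕ)
    (hd : Module.finrank ℝ E = 2 * d) : ∫ x : E, G x = ((Real.pi ^ d : ℝ) : ℂ) := by
  unfold G
  rw [integral_complex_ofReal]
  congr 1
  have := GaussianFourier.integral_rexp_neg_mul_sq_norm (V := E) one_pos
  simp only [neg_mul, one_mul, div_one] at this
  rw [this, hd]
  push_cast
  rw [mul_div_cancel_left₀ _ (two_ne_zero), Real.rpow_natCast]

lemma main [FiniteDimensional ℝ E] [MeasurableSpace E] [BorelSpace E] [Nontrivial E] (d : ℕ)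
    (h0 : 0 < d)
    (hd : Module.finrank ℝ E = 2 * d) {M N : ℕ} (a : Fin M → E) (b : Fin N → E) :
    ∫ x : sphere (0 : E) 1, P a b x ∂(volume : Measure E).toSphere =
      if h : N = M then
        ((2 * Real.pi ^ d / (Nat.factorial (N + d - 1)) : ℝ) : ℂ) *
          ∑ σ : Equiv.Perm (Fin N),
            ∏ i : Fin N, ⟪a (Fin.cast h i), b (σ i)⟫_ℂ
      else 0 := by
  have hp := polar a b
  rw [hd] at hp
  split_ifs with h
  · subst h
    rw [wick_eq, integral_G d hd] at hp
    have e : ((N + N + 2 * d : ℕ) : ℝ) / 2 = ((N + d - 1 : ℕ) : ℝ) + 1 := by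
      rw [← Nat.cast_succ, Nat.succ_eq_add_one, Nat.sub_add_cancel (by omega)]
      push_cast; ring
    rw [e, Real.Gamma_nat_eq_factorial] at hp
    have hf : ((N + d - 1).factorial : ℂ) ≠ 0 := by exact_mod_cast Nat.factorial_ne_zero _
    simp only [Fin.cast_refl, id]
    push_cast at hp ⊢
    field_simp
    linear_combination -2 * hp
  · rw [wick_ne h] at hp
    have : Real.Gamma (((M + N + 2 * d : ℕ) : ℝ) / 2) > 0 :=
      Real.Gamma_pos_of_pos (by have : 0 < M + N + 2 * d := by omega
                                positivity)
    rcases mul_eq_zero.1 hp.symm with h1 | h1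
    · exact h1
    · exfalso
      rw [Complex.ofReal_eq_zero] at h1
      linarith

end SphereAux

/-- complex spherical moment formula. -/
theorem complex_sphere_integral (d : ℕ) (hd : 0 < d) (N M : ℕ)
    (a : Fin M → EuclideanSpace ℂ (Fin d)) (b : Fin N → EuclideanSpace ℂ (Fin d)) :
    ∫ φ : sphere (0 : EuclideanSpace ℂ (Fin d)) 1,
        (∏ i : Fin M, ⟪a i, (φ : EuclideanSpace ℂ (Fin d))⟫_ℂ) *
        (∏ j : Fin N, ⟪(φ : EuclideanSpace ℂ (Fin d)), b j⟫_ℂ) ∂(sphereMeasure d) =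
      if h : N = M then
        ((2 * Real.pi ^ d / (Nat.factorial (N + d - 1)) : ℝ) : ℂ) *
          ∑ σ : Equiv.Perm (Fin N),
            ∏ i : Fin N, ⟪a (Fin.cast h i), b (σ i)⟫_ℂ
      else 0 := by
  have : Nonempty (Fin d) := ⟨⟨0, hd⟩⟩
  have hfr : Module.finrank ℝ (EuclideanSpace ℂ (Fin d)) = 2 * d := by
    rw [← Module.finrank_mul_finrank ℝ ℂ]; simp
  exact SphereAux.main d hd hfr a b
end

section
/- Let $H$ be a finite-dimensional real Hilbert space of dimension $d$, and let $\hat H$ be its unit sphere with the induced surface measure. For any $N \in \mathbb{N}$ and vectors $a_1,\dots,a_{2N} \in H$, one has $\int_{\hat H} \prod_{i=1}^{2N} \langle \hat\varphi, a_i\rangle \, d\hat\varphi = \frac{\pi^{d/2}}{2^{N-1}\Gamma(N+d/2)} \sum_{\theta \in \mathfrak{P}_{2N}} \prod_{\{i,j\}\in\theta} \langle a_i, a_j\rangle$, where $\mathfrak{P}_{2N}$ is the set of partitions of $\{1,\dots,2N\}$ into pairs. -/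
open MeasureTheory Metric
open scoped InnerProductSpace

/-- A pairing of `Fin n`: a set of ordered pairs `(i,j)` with `i < j` such that every element
of `Fin n` belongs to exactly one pair. -/
def IsPairing (n : ℕ) (θ : Finset (Fin n × Fin n)) : Prop :=
  (∀ p ∈ θ, p.1 < p.2) ∧ ∀ i : Fin n, ∃! p : Fin n × Fin n, p ∈ θ ∧ (p.1 = i ∨ p.2 = i)

/-- The surface measure on the unit sphere of `ℝ^d`, induced from Lebesgue measure. -/
noncomputable def sphereMeasureReal (d : ℕ) :
    Measure (sphere (0 : EuclideanSpace ℝ (Fin d)) 1) :=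
  (volume : Measure (EuclideanSpace ℝ (Fin d))).toSphere

section Aux

variable {E : Type*} [NormedAddCommGroup E] [InnerProductSpace ℝ E] [FiniteDimensional ℝ E]
  [MeasurableSpace E] [BorelSpace E]

/-- Gaussian moment over the index set `s`. -/
noncomputable def gaussMoment {ι : Type*} (a : ι → E) (s : Finset ι) : ℝ :=
  ∫ x : E, (∏ i ∈ s, ⟪x, a i⟫_ℝ) * Real.exp (-‖x‖ ^ 2)

lemma gauss_integrable [Nontrivial E] {ι : Type*} (a : ι → E) (s : Finset ι) :
    Integrable (fun x : E => (∏ i ∈ s, ⟪x, a i⟫_ℝ) * Real.exp (-‖x‖ ^ 2)) := by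
  have h1 : Integrable (fun x : E => ‖x‖ ^ s.card * Real.exp (-‖x‖ ^ 2)) := by
    rw [integrable_fun_norm_addHaar volume (f := fun r => r ^ s.card * Real.exp (-r ^ 2))]
    have := integrableOn_rpow_mul_exp_neg_mul_sq (b := 1) one_pos
      (s := ((Module.finrank ℝ E - 1 + s.card : ℕ) : ℝ))
      (by have : (0:ℝ) ≤ ((Module.finrank ℝ E - 1 + s.card : ℕ) : ℝ) := Nat.cast_nonneg _
          linarith)
    refine this.congr_fun (fun x hx => ?_) measurableSet_Ioi
    simp only [Real.rpow_natCast, smul_eq_mul, pow_add, mul_assoc, neg_mul, one_mul]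
  refine (h1.const_mul (∏ i ∈ s, ‖a i‖)).mono' ?_ ?_
  · apply Continuous.aestronglyMeasurable
    fun_prop
  · refine Filter.Eventually.of_forall fun x => ?_
    rw [norm_mul, Real.norm_of_nonneg (Real.exp_nonneg _), ← mul_assoc, norm_prod]
    gcongr
    calc ∏ i ∈ s, ‖⟪x, a i⟫_ℝ‖ ≤ ∏ i ∈ s, (‖a i‖ * ‖x‖) := by
          apply Finset.prod_le_prod
          · intros; positivity
          · intro i _
            rw [mul_comm]; exact norm_inner_le_norm _ _
      _ = _ := by rw [Finset.prod_mul_distrib, Finset.prod_const]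

lemma gaussMoment_empty {ι : Type*} (a : ι → E) :
    gaussMoment a ∅ = Real.pi ^ ((Module.finrank ℝ E : ℝ) / 2) := by
  have := GaussianFourier.integral_rexp_neg_mul_sq_norm (V := E) (b := 1) one_pos
  simpa [gaussMoment] using this

lemma gaussMoment_rec [Nontrivial E] {ι : Type*} [DecidableEq ι] (a : ι → E) (s : Finset ι)
    (m : ι) (hm : m ∈ s) :
    gaussMoment a s = ∑ j ∈ s.erase m,
      (1 / 2) * ⟪a m, a j⟫_ℝ * gaussMoment a ((s.erase m).erase j) := by
  have hf : ∀ x : E, HasFDerivAt (fun x : E => ∏ i ∈ s.erase m, ⟪x, a i⟫_ℝ)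
      (∑ j ∈ s.erase m, (∏ i ∈ (s.erase m).erase j, ⟪x, a i⟫_ℝ) • innerSL ℝ (a j)) x := by
    intro x
    apply HasFDerivAt.finsetProd
    intro i _
    have := (innerSL ℝ (a i)).hasFDerivAt (x := x)
    refine this.congr_of_eventuallyEq (Filter.Eventually.of_forall fun y => ?_)
    simp only [innerSL_apply_apply]
    exact real_inner_comm _ _
  have hg : ∀ x : E, HasFDerivAt (fun x : E => Real.exp (-‖x‖ ^ 2))
      (Real.exp (-‖x‖ ^ 2) • (-((2 : ℝ) • innerSL ℝ x))) x := by
    intro x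
    have := ((hasStrictFDerivAt_norm_sq x).hasFDerivAt.neg).exp
    convert! this using 2
    simp [two_smul]
  have e1 : ∀ x : E, (∑ j ∈ s.erase m, (∏ i ∈ (s.erase m).erase j, ⟪x, a i⟫_ℝ) • innerSL ℝ (a j)) (a m)
      * Real.exp (-‖x‖ ^ 2) = ∑ j ∈ s.erase m, ⟪a m, a j⟫_ℝ *
        ((∏ i ∈ (s.erase m).erase j, ⟪x, a i⟫_ℝ) * Real.exp (-‖x‖ ^ 2)) := by
    intro x
    simp only [ContinuousLinearMap.sum_apply, ContinuousLinearMap.smul_apply, innerSL_apply_apply,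
      smul_eq_mul, Finset.sum_mul]
    refine Finset.sum_congr rfl fun j _ => ?_
    rw [real_inner_comm]; ring
  have e2 : ∀ x : E, (∏ i ∈ s.erase m, ⟪x, a i⟫_ℝ) *
      (Real.exp (-‖x‖ ^ 2) • (-((2 : ℝ) • innerSL ℝ x))) (a m) =
      (-2) * ((∏ i ∈ s, ⟪x, a i⟫_ℝ) * Real.exp (-‖x‖ ^ 2)) := by
    intro x
    rw [← Finset.mul_prod_erase s _ hm]
    simp only [ContinuousLinearMap.neg_apply, ContinuousLinearMap.smul_apply, innerSL_apply_apply,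
      smul_eq_mul]
    ring
  have key := integral_bilinear_hasFDerivAt_right_eq_neg_left_of_integrable (μ := (volume : Measure E))
    (B := ContinuousLinearMap.mul ℝ ℝ) (v := a m)
    (f := fun x : E => ∏ i ∈ s.erase m, ⟪x, a i⟫_ℝ)
    (g := fun x : E => Real.exp (-‖x‖ ^ 2))
    (f' := fun x => ∑ j ∈ s.erase m, (∏ i ∈ (s.erase m).erase j, ⟪x, a i⟫_ℝ) • innerSL ℝ (a j))
    (g' := fun x => Real.exp (-‖x‖ ^ 2) • (-((2 : ℝ) • innerSL ℝ x)))
    (by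
      simp only [ContinuousLinearMap.mul_apply', e1]
      exact integrable_finsetSum _ fun j _ => (gauss_integrable a _).const_mul _)
    (by
      simp only [ContinuousLinearMap.mul_apply', e2]
      exact (gauss_integrable a _).const_mul _)
    (by
      simp only [ContinuousLinearMap.mul_apply']
      exact gauss_integrable a _)
    (fun x _ => hf x) (fun x _ => hg x)
  simp only [ContinuousLinearMap.mul_apply', e1, e2] at key
  rw [integral_finsetSum _ (fun j _ => (gauss_integrable a _).const_mul _)] at key
  simp only [integral_const_mul] at key
  change -2 * gaussMoment a s = -∑ j ∈ s.erase m, ⟪a m, a j⟫_ℝ * gaussMoment a ((s.erase m).erase j) at key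
  simp only [mul_assoc, ← Finset.mul_sum]
  linarith

/-- polar coordinates -/
lemma gaussMoment_polar [Nontrivial E] {ι : Type*} (a : ι → E) (s : Finset ι) :
    gaussMoment a s = (∫ φ : sphere (0 : E) 1, (∏ i ∈ s, ⟪(φ : E), a i⟫_ℝ)
      ∂(volume : Measure E).toSphere) *
      ((1 / 2) * Real.Gamma (((s.card : ℝ) + Module.finrank ℝ E) / 2)) := by
  have hd : 0 < Module.finrank ℝ E := Module.finrank_pos
  set n := Module.finrank ℝ E - 1 with hn
  have hrad : ∫ r : Set.Ioi (0 : ℝ), (r : ℝ) ^ s.card * Real.exp (-(r : ℝ) ^ 2)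
      ∂(Measure.volumeIoiPow n) =
      (1 / 2) * Real.Gamma (((s.card : ℝ) + Module.finrank ℝ E) / 2) := by
    simp only [Measure.volumeIoiPow, ENNReal.ofReal]
    rw [integral_withDensity_eq_integral_smul,
      integral_subtype_comap measurableSet_Ioi
        fun r : ℝ ↦ Real.toNNReal (r ^ n) • (r ^ s.card * Real.exp (-r ^ 2))]
    · have := integral_rpow_mul_exp_neg_rpow (p := 2) (q := ((n + s.card : ℕ) : ℝ)) two_pos
        (by have : (0:ℝ) ≤ ((n + s.card : ℕ) : ℝ) := Nat.cast_nonneg _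
            linarith)
      have h2 : ((n + s.card : ℕ) : ℝ) + 1 = (s.card : ℝ) + Module.finrank ℝ E := by
        have : Module.finrank ℝ E = n + 1 := by omega
        rw [this]; push_cast; ring
      rw [h2] at this
      rw [← this]
      refine setIntegral_congr_fun measurableSet_Ioi fun x hx => ?_
      simp only [NNReal.smul_def, Real.coe_toNNReal _ (pow_nonneg (Set.mem_Ioi.1 hx).le n),
        Real.rpow_natCast, smul_eq_mul, pow_add, mul_assoc, Real.rpow_two]
    · exact (measurable_subtype_coe.pow_const _).real_toNNReal
  rw [← hrad, ← integral_prod_mul, gaussMoment]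
  calc
    _ = ∫ x : ({(0)}ᶜ : Set E), (∏ i ∈ s, ⟪x.1, a i⟫_ℝ) * Real.exp (-‖x.1‖ ^ 2)
        ∂((volume : Measure E).comap (↑)) := by
      rw [integral_subtype_comap (measurableSet_singleton _).compl
        fun x : E ↦ (∏ i ∈ s, ⟪x, a i⟫_ℝ) * Real.exp (-‖x‖ ^ 2), restrict_compl_singleton]
    _ = _ := by
      rw [← (volume : Measure E).measurePreserving_homeomorphUnitSphereProd.integral_comp
        (Homeomorph.measurableEmbedding _)]
      refine integral_congr_ae (Filter.Eventually.of_forall fun x => ?_)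
      have hx : ‖x.1‖ ≠ 0 := norm_ne_zero_iff.2 x.2
      simp only [homeomorphUnitSphereProd_apply_fst_coe, homeomorphUnitSphereProd_apply_snd_coe,
        real_inner_smul_left, Finset.prod_mul_distrib, Finset.prod_const]
      have h1 : ‖x.1‖⁻¹ ^ s.card * ‖x.1‖ ^ s.card = 1 := by
        rw [← mul_pow, inv_mul_cancel₀ hx, one_pow]
      linear_combination -((∏ i ∈ s, ⟪x.1, a i⟫_ℝ) * Real.exp (-‖x.1‖ ^ 2)) * h1

end Aux

section Comb

variable {ι : Type*} [LinearOrder ι]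

/-- pairing of a finite set -/
def PairingOn (s : Finset ι) (θ : Finset (ι × ι)) : Prop :=
  (∀ p ∈ θ, p.1 < p.2 ∧ p.1 ∈ s ∧ p.2 ∈ s) ∧
    ∀ i ∈ s, ∃! p : ι × ι, p ∈ θ ∧ (p.1 = i ∨ p.2 = i)

lemma PairingOn.uniq {s : Finset ι} {θ : Finset (ι × ι)} (h : PairingOn s θ) {p q : ι × ι}
    (hp : p ∈ θ) (hq : q ∈ θ) {i : ι} (hpi : p.1 = i ∨ p.2 = i) (hqi : q.1 = i ∨ q.2 = i) :
    p = q := by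
  have hi : i ∈ s := by
    rcases hpi with rfl | rfl
    · exact (h.1 p hp).2.1
    · exact (h.1 p hp).2.2
  exact (h.2 i hi).unique ⟨hp, hpi⟩ ⟨hq, hqi⟩

lemma PairingOn.insert {s : Finset ι} {θ : Finset (ι × ι)} {m j : ι} (hm : m ∈ s) (hj : j ∈ s)
    (hmj : m < j) (h : PairingOn ((s.erase m).erase j) θ) : PairingOn s (insert (m, j) θ) := by
  refine ⟨?_, ?_⟩
  · intro p hp
    rcases Finset.mem_insert.1 hp with rfl | hp
    · exact ⟨hmj, hm, hj⟩
    · have := h.1 p hp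
      simp only [Finset.mem_erase] at this
      tauto
  · intro i hi
    by_cases hi2 : i = m ∨ i = j
    · refine ⟨(m, j), ⟨Finset.mem_insert_self _ _, by tauto⟩, ?_⟩
      rintro p ⟨hp, hpi⟩
      rcases Finset.mem_insert.1 hp with rfl | hp
      · rfl
      · have := h.1 p hp
        simp only [Finset.mem_erase] at this
        grind
    · push Not at hi2
      obtain ⟨p, hp, hu⟩ := h.2 i (by simp [hi, hi2])
      refine ⟨p, ⟨Finset.mem_insert_of_mem hp.1, hp.2⟩, ?_⟩
      rintro q ⟨hq, hqi⟩
      rcases Finset.mem_insert.1 hq with rfl | hq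
      · exfalso; simp only at hqi; grind
      · exact hu q ⟨hq, hqi⟩

lemma PairingOn.erase {s : Finset ι} {θ : Finset (ι × ι)} {m j : ι}
    (h : PairingOn s θ) (hmem : (m, j) ∈ θ) :
    PairingOn ((s.erase m).erase j) (θ.erase (m, j)) := by
  refine ⟨?_, ?_⟩
  · intro p hp
    have hp' := Finset.mem_erase.1 hp
    have h1 := h.1 p hp'.2
    refine ⟨h1.1, ?_, ?_⟩ <;> simp only [Finset.mem_erase] <;> refine ⟨?_, ?_, by tauto⟩ <;>
      intro he <;> apply hp'.1
    · exact h.uniq hp'.2 hmem (i := j) (by simp [he]) (by simp)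
    · exact h.uniq hp'.2 hmem (i := m) (by simp [he]) (by simp)
    · exact h.uniq hp'.2 hmem (i := j) (by simp [he]) (by simp)
    · exact h.uniq hp'.2 hmem (i := m) (by simp [he]) (by simp)
  · intro i hi
    simp only [Finset.mem_erase] at hi
    obtain ⟨p, hp, hu⟩ := h.2 i hi.2.2
    refine ⟨p, ⟨Finset.mem_erase.2 ⟨?_, hp.1⟩, hp.2⟩, ?_⟩
    · rintro rfl
      have := hp.2
      simp only at this
      grind
    · rintro q ⟨hq, hqi⟩
      exact hu q ⟨(Finset.mem_erase.1 hq).2, hqi⟩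

open Classical in
/-- the sum over pairings -/
noncomputable def pairSum [Fintype ι] (w : ι → ι → ℝ) (s : Finset ι) : ℝ :=
  ∑ θ ∈ Finset.univ.filter (fun θ => PairingOn s θ), ∏ p ∈ θ, w p.1 p.2

lemma pairSum_empty [Fintype ι] (w : ι → ι → ℝ) : pairSum w ∅ = 1 := by
  classical
  have : Finset.univ.filter (fun θ => PairingOn (∅ : Finset ι) θ) = {∅} := by
    ext θ
    simp only [Finset.mem_filter, Finset.mem_univ, true_and, Finset.mem_singleton]
    constructor
    · intro h
      refine Finset.eq_empty_of_forall_notMem fun p hp => ?_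
      have := (h.1 p hp).2.1
      simp at this
    · rintro rfl
      exact ⟨by simp, by simp⟩
  rw [pairSum]
  refine (Finset.sum_congr (by convert this) (fun _ _ => rfl)).trans
    (by simp : ∑ θ ∈ ({∅} : Finset (Finset (ι × ι))), ∏ p ∈ θ, w p.1 p.2 = 1)

lemma pairSum_rec [Fintype ι] (w : ι → ι → ℝ) (s : Finset ι) (m : ι) (hm : m ∈ s)
    (hmin : ∀ i ∈ s, m ≤ i) :
    pairSum w s = ∑ j ∈ s.erase m, w m j * pairSum w ((s.erase m).erase j) := by
  classical
  simp only [pairSum, Finset.mul_sum]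
  rw [Finset.sum_sigma']
  symm
  have hnot : ∀ (j : ι) (θ : Finset (ι × ι)), PairingOn ((s.erase m).erase j) θ →
      ∀ k, (m, k) ∉ θ := by
    intro j θ h k hk
    have := (h.1 _ hk).2.1
    simp at this
  refine Finset.sum_bij (fun x _ => insert (m, x.1) x.2) ?_ ?_ ?_ ?_
  · rintro ⟨j, θ⟩ hx
    simp only [Finset.mem_sigma, Finset.mem_erase, Finset.mem_filter, Finset.mem_univ,
      true_and] at hx ⊢
    exact PairingOn.insert hm hx.1.2 (lt_of_le_of_ne (hmin j hx.1.2) (Ne.symm hx.1.1)) hx.2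
  · rintro ⟨j, θ⟩ hx ⟨j', θ'⟩ hx' heq
    simp only [Finset.mem_sigma, Finset.mem_erase, Finset.mem_filter, Finset.mem_univ,
      true_and] at hx hx' heq
    have h1 : (m, j) ∈ insert (m, j') θ' := heq ▸ Finset.mem_insert_self _ _
    have hj : j = j' := by
      rcases Finset.mem_insert.1 h1 with h | h
      · exact (Prod.mk.inj h).2
      · exact absurd h (hnot _ _ hx'.2 _)
    subst hj
    have : θ = θ' := by
      rw [← Finset.erase_insert (hnot _ _ hx.2 j), heq, Finset.erase_insert (hnot _ _ hx'.2 j)]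
    rw [this]
  · intro θ hθ
    simp only [Finset.mem_filter, Finset.mem_univ, true_and] at hθ
    obtain ⟨p, ⟨hp, hpm⟩, -⟩ := hθ.2 m hm
    have hp1 := hθ.1 p hp
    have hpm1 : p.1 = m := by
      rcases hpm with h | h
      · exact h
      · exact absurd hp1.1 (not_lt.2 (h ▸ hmin _ hp1.2.1))
    obtain ⟨p1, j⟩ := p
    simp only at hpm1 hp1
    subst hpm1
    refine ⟨⟨j, θ.erase (p1, j)⟩, ?_, ?_⟩
    · simp only [Finset.mem_sigma, Finset.mem_erase, Finset.mem_filter, Finset.mem_univ, true_and]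
      exact ⟨⟨hp1.1.ne', hp1.2.2⟩, hθ.erase hp⟩
    · exact Finset.insert_erase hp
  · rintro ⟨j, θ⟩ hx
    simp only [Finset.mem_sigma, Finset.mem_erase, Finset.mem_filter, Finset.mem_univ,
      true_and] at hx
    simp only
    rw [Finset.prod_insert (hnot _ _ hx.2 j)]

end Comb

lemma gaussMoment_eq {E : Type*} [NormedAddCommGroup E] [InnerProductSpace ℝ E]
    [FiniteDimensional ℝ E] [MeasurableSpace E] [BorelSpace E] [Nontrivial E]
    {ι : Type*} [LinearOrder ι] [Fintype ι] (a : ι → E) (N : ℕ) :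
    ∀ s : Finset ι, s.card = 2 * N →
      gaussMoment a s = Real.pi ^ ((Module.finrank ℝ E : ℝ) / 2) * (1 / 2) ^ N *
        pairSum (fun i j => ⟪a i, a j⟫_ℝ) s := by
  induction N with
  | zero =>
    intro s hs
    obtain rfl : s = ∅ := Finset.card_eq_zero.1 (by simpa using hs)
    rw [gaussMoment_empty, pairSum_empty]; simp
  | succ N ih =>
    intro s hs
    have hne : s.Nonempty := Finset.card_pos.1 (by omega)
    have hm := s.min'_mem hne
    rw [gaussMoment_rec a s _ hm, pairSum_rec _ s _ hm (fun i hi => s.min'_le i hi),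
      Finset.mul_sum]
    refine Finset.sum_congr rfl fun j hj => ?_
    rw [ih]
    · ring
    · rw [Finset.card_erase_of_mem hj, Finset.card_erase_of_mem hm]; omega

open Classical in
/-- real spherical moment formula. -/
theorem real_sphere_integral (d : ℕ) (hd : 0 < d) (N : ℕ)
    (a : Fin (2 * N) → EuclideanSpace ℝ (Fin d)) :
    ∫ φ : sphere (0 : EuclideanSpace ℝ (Fin d)) 1,
        (∏ i : Fin (2 * N), ⟪(φ : EuclideanSpace ℝ (Fin d)), a i⟫_ℝ) ∂(sphereMeasureReal d) =
      (Real.pi ^ ((d : ℝ) / 2) / ((2 : ℝ) ^ ((N : ℤ) - 1) * Real.Gamma ((N : ℝ) + (d : ℝ) / 2))) *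
        ∑ θ ∈ Finset.univ.filter (fun θ => IsPairing (2 * N) θ),
          ∏ p ∈ θ, ⟪a p.1, a p.2⟫_ℝ := by
  haveI : Nonempty (Fin d) := ⟨⟨0, hd⟩⟩
  have h1 := gaussMoment_eq a N Finset.univ (by simp)
  rw [gaussMoment_polar] at h1
  have h2 : pairSum (fun i j => ⟪a i, a j⟫_ℝ) Finset.univ =
      ∑ θ ∈ Finset.univ.filter (fun θ => IsPairing (2 * N) θ), ∏ p ∈ θ, ⟪a p.1, a p.2⟫_ℝ := by
    rw [pairSum]
    refine Finset.sum_congr ?_ fun _ _ => rfl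
    ext θ
    simp [PairingOn, IsPairing]
  rw [h2] at h1
  simp only [Finset.card_univ, Fintype.card_fin, finrank_euclideanSpace] at h1
  have h3 : (((2 * N : ℕ) : ℝ) + d) / 2 = (N : ℝ) + (d : ℝ) / 2 := by push_cast; ring
  rw [h3] at h1
  have hG : 0 < Real.Gamma ((N : ℝ) + (d : ℝ) / 2) := Real.Gamma_pos_of_pos (by positivity)
  rw [sphereMeasureReal, zpow_sub₀ two_ne_zero, zpow_natCast, zpow_one]
  rw [div_mul_eq_mul_div, eq_div_iff (by positivity)]
  have h4 : ((1 : ℝ) / 2) ^ N * 2 ^ N = 1 := by rw [← mul_pow]; norm_num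
  linear_combination (2 ^ N) * h1 + (Real.pi ^ ((d : ℝ) / 2) *
    ∑ θ ∈ Finset.univ.filter (fun θ => IsPairing (2 * N) θ), ∏ p ∈ θ, ⟪a p.1, a p.2⟫_ℝ) * h4
end

section
/- Let $(A,B)$ be a jointly Gaussian centred real random vector with variances $\sigma_A^2 = \mathbb{E}[A^2]$, $\sigma_B^2 = \mathbb{E}[B^2]$ and covariance $\sigma_{AB} = \mathbb{E}[AB]$, with $\sigma_A^2 > 0$. Then for all $\eta < \tfrac{1}{2}\sigma_A^{-2}$, $\mathbb{E}[e^{\eta A^2}\cos B] = \exp\Big[\frac{\sigma_{AB}^2}{2\sigma_A^2}\Big(1 - \frac{1}{1-2\eta\sigma_A^2}\Big)\Big]\, \mathbb{E}[e^{\eta A^2}]\, \mathbb{E}[\cos B]$. -/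
open MeasureTheory ProbabilityTheory

lemma aux_oneD (v : ℝ) (hv : 0 < v) (η : ℝ) (hη : η < 1 / (2 * v)) :
    ∃ K : ℂ, K ≠ 0 ∧ ∀ κ : ℝ,
      ∫ x : ℝ, Complex.exp (η * x ^ 2 + κ * x * Complex.I) ∂(gaussianReal 0 v.toNNReal) =
        K * Complex.exp (-(κ ^ 2 * v / (2 * (1 - 2 * η * v)))) := by
  have hv' : v.toNNReal ≠ 0 := by simpa using hv
  have hvc : (v : ℂ) ≠ 0 := by exact_mod_cast hv.ne'
  have h1 : 0 < 1 - 2 * η * v := by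
    rw [lt_div_iff₀ (by positivity)] at hη
    linarith
  have h1c : (1 - 2 * η * v : ℂ) ≠ 0 := by exact_mod_cast h1.ne'
  set b : ℝ := η - 1 / (2 * v) with hbdef
  have hb : b < 0 := by linarith
  have hbc : (b : ℂ) ≠ 0 := by exact_mod_cast hb.ne
  have hpi : (Real.pi : ℂ) ≠ 0 := by exact_mod_cast Real.pi_ne_zero
  refine ⟨((√(2 * Real.pi * v))⁻¹ : ℝ) * (Real.pi / -b : ℂ) ^ (1 / 2 : ℂ), ?_, ?_⟩
  · refine mul_ne_zero ?_ ?_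
    · have : 0 < (√(2 * Real.pi * v))⁻¹ := by positivity
      exact_mod_cast this.ne'
    · rw [Complex.cpow_ne_zero_iff]
      left
      exact div_ne_zero hpi (neg_ne_zero.mpr hbc)
  · intro κ
    rw [integral_gaussianReal_eq_integral_smul hv']
    have hpt : ∀ x : ℝ, gaussianPDFReal 0 v.toNNReal x •
        Complex.exp (η * x ^ 2 + κ * x * Complex.I) =
        ((√(2 * Real.pi * v))⁻¹ : ℝ) *
          Complex.exp ((b : ℂ) * x ^ 2 + (κ * Complex.I) * x + 0) := by
      intro x
      rw [gaussianPDFReal_def, Complex.real_smul]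
      simp only [Real.coe_toNNReal v hv.le, Complex.ofReal_mul, Complex.ofReal_exp]
      rw [mul_assoc, ← Complex.exp_add]
      congr 2
      rw [hbdef]
      push_cast
      field_simp
      ring
    simp_rw [hpt]
    rw [integral_const_mul, integral_cexp_quadratic (by simpa using hb), ← mul_assoc]
    congr 2
    have hb2 : (b : ℂ) = -(1 - 2 * η * v) / (2 * v) := by
      rw [hbdef]; push_cast; field_simp; ring
    rw [hb2, mul_pow, Complex.I_sq]
    field_simp
    ring

theorem gaussian_exp_sq_cos_identity
    {Ω : Type*} [MeasurableSpace Ω] (P : Measure Ω) [IsProbabilityMeasure P]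
    (A B : Ω → ℝ) (vA vB cAB : ℝ) (hvA : 0 < vA)
    (hGauss : ∀ s t : ℝ, Measure.map (fun ω => s * A ω + t * B ω) P =
      gaussianReal 0 (s ^ 2 * vA + 2 * s * t * cAB + t ^ 2 * vB).toNNReal)
    (η : ℝ) (hη : η < 1 / (2 * vA)) :
    ∫ ω, Real.exp (η * A ω ^ 2) * Real.cos (B ω) ∂P =
      Real.exp (cAB ^ 2 / (2 * vA) * (1 - 1 / (1 - 2 * η * vA))) *
        ((∫ ω, Real.exp (η * A ω ^ 2) ∂P) * ∫ ω, Real.cos (B ω) ∂P) := by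
  have hae : ∀ s t : ℝ, AEMeasurable (fun ω => s * A ω + t * B ω) P := by
    intro s t
    apply AEMeasurable.of_map_ne_zero
    rw [hGauss]
    exact IsProbabilityMeasure.ne_zero _
  have hA : AEMeasurable A P := by simpa using hae 1 0
  have hB : AEMeasurable B P := by simpa using hae 0 1
  have hAlaw : P.map A = gaussianReal 0 vA.toNNReal := by simpa using hGauss 1 0
  set κ : ℝ := cAB / vA with hκ
  set d : ℝ := vB - cAB ^ 2 / vA with hd
  set C : Ω → ℝ := fun ω => B ω - κ * A ω with hC
  have hCm : AEMeasurable C P := by fun_prop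
  have hG2 : ∀ s t : ℝ, P.map (fun ω => s * A ω + t * C ω) =
      gaussianReal 0 (s ^ 2 * vA + t ^ 2 * d).toNNReal := by
    intro s t
    have := hGauss (s - t * κ) t
    convert this using 2
    · funext ω; simp only [hC]; ring
    · congr 1
      rw [hd, hκ]; field_simp; ring
  have hd0 : 0 ≤ d := by
    by_contra hneg
    push Not at hneg
    have hC0 : P.map C = Measure.dirac 0 := by
      have := hG2 0 1
      simpa [Real.toNNReal_of_nonpos hneg.le] using this
    have hCae : ∀ᵐ ω ∂P, C ω = 0 := by
      have : ∀ᵐ x ∂(P.map C), x = 0 := by rw [hC0]; simp [ae_dirac_eq]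
      exact ae_of_ae_map hCm this
    have h1 : P.map (fun ω => 1 * A ω + 1 * C ω) = P.map A := by
      apply Measure.map_congr
      filter_upwards [hCae] with ω hω
      simp [hω]
    rw [hG2, hAlaw, gaussianReal_ext_iff] at h1
    have h2 := congrArg NNReal.toReal h1.2
    rw [Real.coe_toNNReal', Real.coe_toNNReal'] at h2
    rcases max_cases (1 ^ 2 * vA + 1 ^ 2 * d) 0 with h | h <;>
      rcases max_cases vA 0 with h' | h' <;> linarith
  have hClaw : P.map C = gaussianReal 0 d.toNNReal := by simpa using hG2 0 1
  have hind : IndepFun A C P := by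
    rw [indepFun_iff_charFun_prod hA hCm]
    intro t
    rw [hAlaw, hClaw, charFun_gaussianReal, charFun_gaussianReal]
    have h := congrArg (fun μ => charFun μ 1) (hG2 t.ofLp.1 t.ofLp.2)
    simp only [charFun_gaussianReal] at h
    rw [charFun_apply_real, integral_map (by fun_prop) (by fun_prop)] at h
    rw [charFun_apply, integral_map (by fun_prop) (by fun_prop)]
    have h0 : 0 ≤ t.ofLp.1 ^ 2 * vA + t.ofLp.2 ^ 2 * d := by positivity
    rw [Real.coe_toNNReal _ h0] at h
    rw [Real.coe_toNNReal _ hvA.le, Real.coe_toNNReal _ hd0, ← Complex.exp_add]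
    convert h using 1
    · congr 1; funext ω
      simp [WithLp.prod_inner_apply]
    · congr 1
      push_cast
      ring
  -- the main complex formula
  have main : ∀ η : ℝ, η < 1 / (2 * vA) →
      ∫ ω, Real.exp (η * A ω ^ 2) * Real.cos (B ω) ∂P =
        Real.exp (-(κ ^ 2 * vA / (2 * (1 - 2 * η * vA)))) * Real.exp (-(d / 2)) *
          ∫ ω, Real.exp (η * A ω ^ 2) ∂P := by
    intro η hη
    obtain ⟨K, hK, hKf⟩ := aux_oneD vA hvA η hη
    have hAint : ∀ κ : ℝ, ∫ ω, Complex.exp (η * A ω ^ 2 + κ * A ω * Complex.I) ∂P =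
        K * Complex.exp (-(κ ^ 2 * vA / (2 * (1 - 2 * η * vA)))) := by
      intro κ
      rw [← hKf, ← hAlaw, integral_map hA (by fun_prop)]
    have hKre : ((∫ ω, Real.exp (η * A ω ^ 2) ∂P : ℝ) : ℂ) = K := by
      have := hAint 0
      simp at this
      rw [← this, ← integral_complex_ofReal]
      congr 1; funext ω; push_cast; rfl
    have hCint : ∫ ω, Complex.exp (C ω * Complex.I) ∂P = Complex.exp (-(d / 2)) := by
      have h := congrArg (fun μ => charFun μ 1) hClaw
      simp only [charFun_gaussianReal] at h
      rw [charFun_apply_real, integral_map (by fun_prop) (by fun_prop)] at h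
      simp [Real.coe_toNNReal _ hd0] at h
      rw [h]
    have hfull : ∫ ω, Complex.exp (η * A ω ^ 2 + B ω * Complex.I) ∂P =
        K * Complex.exp (-(κ ^ 2 * vA / (2 * (1 - 2 * η * vA)))) * Complex.exp (-(d / 2)) := by
      rw [← hAint, ← hCint]
      have := hind.integral_fun_comp_mul_comp
        (f := fun x : ℝ => Complex.exp (η * x ^ 2 + κ * x * Complex.I))
        (g := fun x : ℝ => Complex.exp (x * Complex.I)) hA hCm (by fun_prop) (by fun_prop)
      rw [← this]
      congr 1; funext ω
      rw [← Complex.exp_add]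
      congr 1
      simp only [hC]
      push_cast
      ring
    have hint : Integrable (fun ω => Complex.exp (η * A ω ^ 2 + B ω * Complex.I)) P := by
      by_contra H
      rw [integral_undef H] at hfull
      simp [hK] at hfull
    have hre := integral_re hint
    rw [hfull, ← hKre] at hre
    have e1 : ∀ ω, Real.exp (η * A ω ^ 2) * Real.cos (B ω) =
        RCLike.re (Complex.exp (η * A ω ^ 2 + B ω * Complex.I)) := by
      intro ω
      have : (η * A ω ^ 2 + B ω * Complex.I : ℂ) = ((η * A ω ^ 2 : ℝ) : ℂ) + B ω * Complex.I := by
        push_cast; rfl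
      rw [this]
      simp only [RCLike.re_to_complex, Complex.exp_re, Complex.add_re, Complex.ofReal_re,
        Complex.add_im, Complex.ofReal_im, Complex.mul_re, Complex.mul_im, Complex.I_re,
        Complex.I_im]
      simp
    simp_rw [e1]
    rw [hre, RCLike.re_to_complex]
    rw [← Complex.ofReal_re (Real.exp (-(κ ^ 2 * vA / (2 * (1 - 2 * η * vA)))) *
      Real.exp (-(d / 2)) * ∫ ω, Real.exp (η * A ω ^ 2) ∂P)]
    congr 1
    rw [Complex.ofReal_mul, Complex.ofReal_mul]
    push_cast
    ring
  have hcos := main 0 (by positivity)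
  simp at hcos
  have h1 : 0 < 1 - 2 * η * vA := by
    rw [lt_div_iff₀ (by positivity)] at hη
    linarith
  rw [main η hη, hcos]
  have : Real.exp (-(κ ^ 2 * vA / (2 * (1 - 2 * η * vA)))) =
      Real.exp (cAB ^ 2 / (2 * vA) * (1 - 1 / (1 - 2 * η * vA))) *
        Real.exp (-(κ ^ 2 * vA / 2)) := by
    rw [← Real.exp_add]
    congr 1
    rw [hκ]
    field_simp
    ring
  rw [this]
  ring
end
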